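/- The classes of undirected graphs and of bidirected graphs are stable under marginalisation and conditioning: for every undirected graph (respectively bidirected graph) G with node set V and all disjoint subsets M, C of V, there exists an undirected graph (respectively bidirected graph) H with node set V∖(M∪C) such that J_m(H) = α(J_m(G);M,C). -/

import Mathlib

/-!
Stable mixed graphs: mixed graphs with arrows, arcs and lines; ribbonless,
summary and ancestral graphs; the generating maps α_RG, α_SG, α_AG;
m-connecting paths, m-separation and induced independence models.
-/

namespace StableMixedGraphs

/-- A mixed graph on node type `V`: a node set together with three edge
relations: arrows (`arrow i j` means an arrow from `i` to `j`), arcs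
(two-headed, symmetric) and lines (undirected, symmetric). -/
structure MixedGraph (V : Type) where
  nodes : Set V
  arrow : V → V → Prop
  arc : V → V → Prop
  line : V → V → Prop

namespace MixedGraph

variable {V W : Type}

/-- Wellformedness: arcs and lines are symmetric relations and all edges join
nodes of the graph. -/
def Wf (G : MixedGraph V) : Prop :=
  (∀ i j, G.arc i j → G.arc j i) ∧
  (∀ i j, G.line i j → G.line j i) ∧
  (∀ i j, G.arrow i j ∨ G.arc i j ∨ G.line i j → i ∈ G.nodes ∧ j ∈ G.nodes)

/-- No loops of any of the three kinds. -/
def Loopless (G : MixedGraph V) : Prop :=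
  ∀ i, ¬ G.arrow i i ∧ ¬ G.arc i i ∧ ¬ G.line i i

/-- A loopless mixed graph with a finite node set. -/
def IsLMG (G : MixedGraph V) : Prop := G.Wf ∧ G.Loopless ∧ G.nodes.Finite

/-- `G.anc i j` : `i` is an ancestor of `j`, i.e. there is a
direction-preserving path from `i` to `j`. -/
def anc (G : MixedGraph V) (i j : V) : Prop := Relation.TransGen G.arrow i j

/-- The set of ancestors of nodes of `C`. -/
def anSet (G : MixedGraph V) (C : Set V) : Set V := {a | ∃ c ∈ C, G.anc a c}

/-- `i` lies on a direction-preserving cycle. -/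
def OnDPCycle (G : MixedGraph V) (i : V) : Prop := G.anc i i

/-- `i` is an endpoint of a line. -/
def LineEndpoint (G : MixedGraph V) (i : V) : Prop := ∃ j, G.line i j

/-- Condition (2) of a ribbon: `i` or a descendant of `i` is an endpoint of a
line or lies on a direction-preserving cycle. -/
def RibbonTail (G : MixedGraph V) (i : V) : Prop :=
  ∃ d, (d = i ∨ G.anc i d) ∧ (G.LineEndpoint d ∨ G.OnDPCycle d)

/-- `G` contains a ribbon: a collider V-configuration `⟨h,i,j⟩` with no
endpoint-identical edge between `h` and `j`, whose inner node `i` (or a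
descendant of it) is an endpoint of a line or on a direction-preserving
cycle. -/
def HasRibbon (G : MixedGraph V) : Prop :=
  ∃ h i j, h ≠ i ∧ i ≠ j ∧ h ≠ j ∧ G.RibbonTail i ∧
    ((G.arc h i ∧ G.arc i j ∧ ¬ G.arc h j) ∨
     (G.arrow h i ∧ G.arrow j i ∧ ¬ G.line h j) ∨
     (G.arrow h i ∧ G.arc i j ∧ ¬ G.arrow h j))

/-- A ribbonless graph: a loopless mixed graph with no ribbon. -/
def IsRG (G : MixedGraph V) : Prop := G.IsLMG ∧ ¬ G.HasRibbon

/-- A directed acyclic graph: only arrows, no direction-preserving cycle. -/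
def IsDAG (G : MixedGraph V) : Prop :=
  G.IsLMG ∧ (∀ i j, ¬ G.arc i j) ∧ (∀ i j, ¬ G.line i j) ∧ ∀ i, ¬ G.anc i i

/-- A summary graph: a loopless mixed graph with no arrowhead pointing to an
endpoint of a line and no direction-preserving cycle. -/
def IsSG (G : MixedGraph V) : Prop :=
  G.IsLMG ∧ (∀ i, G.LineEndpoint i → ∀ k, ¬ G.arrow k i ∧ ¬ G.arc k i) ∧
    ∀ i, ¬ G.anc i i

/-- A simple mixed graph: no loops and no multiple edges. -/
def Simple (G : MixedGraph V) : Prop :=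
  G.Loopless ∧ ∀ i j,
    (G.arrow i j → ¬ G.arrow j i ∧ ¬ G.arc i j ∧ ¬ G.line i j) ∧
    (G.arc i j → ¬ G.line i j)

/-- An ancestral graph: a simple mixed graph such that no node is an ancestor
of one of its parents or spouses, and a node with a neighbour has neither
parents nor spouses. -/
def IsAG (G : MixedGraph V) : Prop :=
  G.Wf ∧ G.Simple ∧ G.nodes.Finite ∧
  (∀ i j, G.arrow j i ∨ G.arc j i → ¬ G.anc i j) ∧
  (∀ i, G.LineEndpoint i → ∀ k, ¬ G.arrow k i ∧ ¬ G.arc k i)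

/-- An undirected graph: only lines. -/
def IsUG (G : MixedGraph V) : Prop :=
  G.IsLMG ∧ (∀ i j, ¬ G.arrow i j) ∧ ∀ i j, ¬ G.arc i j

/-- A bidirected graph: only arcs. -/
def IsBG (G : MixedGraph V) : Prop :=
  G.IsLMG ∧ (∀ i j, ¬ G.arrow i j) ∧ ∀ i j, ¬ G.line i j

/-- Image of a mixed graph under a map of node types. -/
def map (f : V → W) (G : MixedGraph V) : MixedGraph W where
  nodes := f '' G.nodes
  arrow a b := ∃ i j, G.arrow i j ∧ f i = a ∧ f j = b
  arc a b := ∃ i j, G.arc i j ∧ f i = a ∧ f j = b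
  line a b := ∃ i j, G.line i j ∧ f i = a ∧ f j = b

end MixedGraph

/-! ### The closure generating new edges (Table 1 of the RG-generating
algorithm), for given marginalisation set `M` and collider set
`S = C ∪ an(C)`.  For every V-configuration whose inner node is a
non-collider in `M` (rows 1–7) or a collider in `S` (rows 8–10) the
endpoint-identical edge between the endpoints is generated, repeatedly
until closure. -/

mutual
  /-- Generated arrows (`GenArrow H M S j i`: arrow from `j` to `i`). -/
  inductive GenArrow {V : Type} (H : MixedGraph V) (M S : Set V) : V → V → Prop
    | base {i j : V} : H.arrow i j → GenArrow H M S i j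
    | row1 {i j m : V} : m ∈ M → j ≠ i →
        GenArrow H M S j m → GenArrow H M S m i → GenArrow H M S j i
    | row2 {i j m : V} : m ∈ M → j ≠ i →
        GenLine H M S j m → GenArrow H M S m i → GenArrow H M S j i
    | row3 {i j m : V} : m ∈ M → j ≠ i →
        GenLine H M S j m → GenArc H M S m i → GenArrow H M S j i
    | row8 {i j s : V} : s ∈ S → j ≠ i →
        GenArrow H M S j s → GenArc H M S s i → GenArrow H M S j i

  /-- Generated arcs. -/
  inductive GenArc {V : Type} (H : MixedGraph V) (M S : Set V) : V → V → Prop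
    | base {i j : V} : H.arc i j → GenArc H M S i j
    | symm {i j : V} : GenArc H M S i j → GenArc H M S j i
    | row4 {i j m : V} : m ∈ M → i ≠ j →
        GenArrow H M S m i → GenArrow H M S m j → GenArc H M S i j
    | row5 {i j m : V} : m ∈ M → i ≠ j →
        GenArrow H M S m i → GenArc H M S m j → GenArc H M S i j
    | row9 {i j s : V} : s ∈ S → i ≠ j →
        GenArc H M S i s → GenArc H M S s j → GenArc H M S i j

  /-- Generated lines. -/
  inductive GenLine {V : Type} (H : MixedGraph V) (M S : Set V) : V → V → Prop
    | base {i j : V} : H.line i j → GenLine H M S i j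
    | symm {i j : V} : GenLine H M S i j → GenLine H M S j i
    | row6 {i j m : V} : m ∈ M → i ≠ j →
        GenLine H M S i m → GenArrow H M S j m → GenLine H M S i j
    | row7 {i j m : V} : m ∈ M → i ≠ j →
        GenLine H M S i m → GenLine H M S m j → GenLine H M S i j
    | row10 {i j s : V} : s ∈ S → i ≠ j →
        GenArrow H M S i s → GenArrow H M S j s → GenLine H M S i j
end

variable {V : Type}

/-- The RG-generating map `α_RG(H;M,C)`: generate all edges of the closure
and delete the nodes of `M ∪ C`. -/
def alphaRG (H : MixedGraph V) (M C : Set V) : MixedGraph V where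
  nodes := H.nodes \ (M ∪ C)
  arrow i j := i ∈ H.nodes \ (M ∪ C) ∧ j ∈ H.nodes \ (M ∪ C) ∧
    GenArrow H M (C ∪ H.anSet C) i j
  arc i j := i ∈ H.nodes \ (M ∪ C) ∧ j ∈ H.nodes \ (M ∪ C) ∧
    GenArc H M (C ∪ H.anSet C) i j
  line i j := i ∈ H.nodes \ (M ∪ C) ∧ j ∈ H.nodes \ (M ∪ C) ∧
    GenLine H M (C ∪ H.anSet C) i j

/-- The arrowhead-removal operation `α_RG.SG(K;A)`: every arrowhead pointing
at a node of `A` is removed (an arrow at such a node becomes a line, an arc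
becomes an arrow, an arc with both endpoints in `A` becomes a line),
repeatedly until closure. -/
def deheadAt (K : MixedGraph V) (A : Set V) : MixedGraph V where
  nodes := K.nodes
  arrow j i := i ∉ A ∧ (K.arrow j i ∨ (K.arc j i ∧ j ∈ A))
  arc i j := K.arc i j ∧ i ∉ A ∧ j ∉ A
  line i j := K.line i j ∨ (K.arrow j i ∧ i ∈ A) ∨ (K.arrow i j ∧ j ∈ A) ∨
    (K.arc i j ∧ i ∈ A ∧ j ∈ A)

/-- The SG-generating map `α_SG(H;M,C)`: mark the nodes of `an(C)`, apply the
RG-generating construction, then remove all arrowheads pointing at marked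
nodes. -/
def alphaSG (H : MixedGraph V) (M C : Set V) : MixedGraph V :=
  deheadAt (alphaRG H M C) (H.anSet C)

/-! ### Step 2 of the AG-generating algorithm: for every V-configuration
`j → k ↔ i` or `j ↔ k ↔ i` with `k ∈ an(i)` (in the current graph) generate
an arrow from `j` to `i`, respectively an arc between `j` and `i`, until
closure. -/

mutual
  inductive AG2Arrow {V : Type} (K : MixedGraph V) : V → V → Prop
    | base {i j : V} : K.arrow j i → AG2Arrow K j i
    | gen {i j k : V} : j ≠ i → AG2Arrow K j k → AG2Arc K k i →
        AG2Anc K k i → AG2Arrow K j i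

  inductive AG2Arc {V : Type} (K : MixedGraph V) : V → V → Prop
    | base {i j : V} : K.arc i j → AG2Arc K i j
    | symm {i j : V} : AG2Arc K i j → AG2Arc K j i
    | gen {i j k : V} : j ≠ i → AG2Arc K j k → AG2Arc K k i →
        AG2Anc K k i → AG2Arc K j i

  /-- The ancestor relation of the graph being generated in step 2. -/
  inductive AG2Anc {V : Type} (K : MixedGraph V) : V → V → Prop
    | single {i j : V} : AG2Arrow K i j → AG2Anc K i j
    | tail {i k j : V} : AG2Arrow K i k → AG2Anc K k j → AG2Anc K i j
end

/-- The graph after step 2 of the AG-generating algorithm. -/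
def ag2 (K : MixedGraph V) : MixedGraph V where
  nodes := K.nodes
  arrow := AG2Arrow K
  arc := AG2Arc K
  line := K.line

/-! ### Step 3 of the AG-generating algorithm: repeatedly replace every arc
between `j` and `i` with `j ∈ an(i)` (in the current graph) by an arrow from
`j` to `i`. -/

mutual
  inductive AG3Arrow {V : Type} (K : MixedGraph V) : V → V → Prop
    | base {i j : V} : K.arrow j i → AG3Arrow K j i
    | conv {i j : V} : K.arc j i → AG3Anc K j i → AG3Arrow K j i

  /-- The ancestor relation of the graph being generated in step 3. -/
  inductive AG3Anc {V : Type} (K : MixedGraph V) : V → V → Prop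
    | single {i j : V} : AG3Arrow K i j → AG3Anc K i j
    | tail {i k j : V} : AG3Arrow K i k → AG3Anc K k j → AG3Anc K i j
end

/-- Steps 2 and 3 of the AG-generating algorithm, applied to a summary
graph: `α_SG.AG`. -/
def alphaSGAG (K : MixedGraph V) : MixedGraph V :=
  let K2 := ag2 K
  { nodes := K.nodes
    arrow := AG3Arrow K2
    arc := fun i j => K2.arc i j ∧ ¬ AG3Anc K2 i j ∧ ¬ AG3Anc K2 j i
    line := K.line }

/-- The AG-generating map `α_AG(H;M,C)`. -/
def alphaAG (H : MixedGraph V) (M C : Set V) : MixedGraph V :=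
  alphaSGAG (alphaSG H M C)

/-! ### Paths, m-connection and m-separation. -/

/-- A step of a walk: it goes from `src` to `tgt` along an edge which has an
arrowhead at `src` iff `hs = true` and an arrowhead at `tgt` iff
`ht = true` (so `hs = ht = false` is a line, `hs = ht = true` an arc, and
exactly one head an arrow in the corresponding direction). -/
structure Step (V : Type) where
  src : V
  tgt : V
  hs : Bool
  ht : Bool

/-- The edge of a step is present in `G`. -/
def Step.valid (G : MixedGraph V) (s : Step V) : Prop :=
  match s.hs, s.ht with
  | false, false => G.line s.src s.tgt
  | false, true  => G.arrow s.src s.tgt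
  | true,  false => G.arrow s.tgt s.src
  | true,  true  => G.arc s.src s.tgt

/-- `w` is a path from `i` to `j` in `G`: a nonempty chained list of valid
steps with no repeated nodes. -/
def IsPath (G : MixedGraph V) (i j : V) (w : List (Step V)) : Prop :=
  w ≠ [] ∧ (∀ s ∈ w, s.valid G) ∧ List.Chain' (fun a b => a.tgt = b.src) w ∧
    w.head?.map Step.src = some i ∧ w.getLast?.map Step.tgt = some j ∧
    (i :: w.map Step.tgt).Nodup

/-- The path `w` is m-connecting given `M` and `C`: every inner collider node
is in `C ∪ an(C)` and every inner non-collider node is in `M`. -/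
def MConnPath (G : MixedGraph V) (M C : Set V) (w : List (Step V)) : Prop :=
  List.Chain'
    (fun a b =>
      (a.ht = true ∧ b.hs = true → a.tgt ∈ C ∪ G.anSet C) ∧
      (¬ (a.ht = true ∧ b.hs = true) → a.tgt ∈ M)) w

/-- `A ⊥_m B | C` in `G` : there is no m-connecting path between `A` and `B`
given `C` (with `M` the remaining nodes). -/
def MSep (G : MixedGraph V) (A B C : Set V) : Prop :=
  ∀ i ∈ A, ∀ j ∈ B, ∀ w : List (Step V),
    IsPath G i j w → ¬ MConnPath G (G.nodes \ (A ∪ B ∪ C)) C w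

/-- The independence model induced by `G` via m-separation: the set of
triples `⟨A,B|C⟩` of pairwise disjoint subsets of the nodes with
`A ⊥_m B | C`. -/
def Jm (G : MixedGraph V) : Set (Set V × Set V × Set V) :=
  {t | t.1 ⊆ G.nodes ∧ t.2.1 ⊆ G.nodes ∧ t.2.2 ⊆ G.nodes ∧
    Disjoint t.1 t.2.1 ∧ Disjoint t.1 t.2.2 ∧ Disjoint t.2.1 t.2.2 ∧
    MSep G t.1 t.2.1 t.2.2}

/-- The independence model after marginalisation over `M` and conditioning on
`C` : `α(J;M,C)`. -/
def alphaIM (J : Set (Set V × Set V × Set V)) (M C : Set V) :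
    Set (Set V × Set V × Set V) :=
  {t | (t.1, t.2.1, t.2.2 ∪ C) ∈ J ∧ (t.1 ∪ t.2.1 ∪ t.2.2) ∩ (M ∪ C) = ∅}

/-! ### Connection through a set, for graphs with a single symmetric type of edge. -/

/-- `Conn E S i j`: there is a walk from `i` to `j` along edges of `E` all of whose
inner nodes are in `S`. -/
inductive Conn (E : V → V → Prop) (S : Set V) : V → V → Prop
  | edge {i j : V} : E i j → Conn E S i j
  | cons {i k j : V} : E i k → k ∈ S → Conn E S k j → Conn E S i j

namespace Conn

variable {E : V → V → Prop} {S T : Set V} {i j k : V}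

theorem mono (hST : S ⊆ T) (h : Conn E S i j) : Conn E T i j := by
  induction h with
  | edge h => exact edge h
  | cons h hk _ ih => exact cons h (hST hk) ih

theorem trans (h : Conn E S i k) (hk : k ∈ S) (h' : Conn E S k j) : Conn E S i j := by
  induction h with
  | edge h => exact cons h hk h'
  | cons h hm _ ih => exact cons h hm (ih hk h')

theorem symm (hE : ∀ i j, E i j → E j i) (h : Conn E S i j) : Conn E S j i := by
  induction h with
  | edge h => exact edge (hE _ _ h)
  | cons h hk _ ih => exact ih.trans hk (edge (hE _ _ h))

end Conn

/-- The relation on the nodes of `N` joining distinct nodes connected through `S`. -/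
def ConnOn (E : V → V → Prop) (S N : Set V) (i j : V) : Prop :=
  i ∈ N ∧ j ∈ N ∧ i ≠ j ∧ Conn E S i j

theorem conn_of_conn_connOn {E : V → V → Prop} {S N T : Set V} {i j : V}
    (h : Conn (ConnOn E S N) T i j) : Conn E (S ∪ T) i j := by
  induction h with
  | edge h => exact h.2.2.2.mono Set.subset_union_left
  | cons h hk _ ih => exact (h.2.2.2.mono Set.subset_union_left).trans (Or.inr hk) ih

/-- A walk through `S ∪ T` decomposes at its first node in `T`. -/
theorem conn_union_split {E : V → V → Prop} {S N T : Set V} {i j : V} (hT : T ⊆ N)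
    (h : Conn E (S ∪ T) i j) (hj : j ∈ N) :
    Conn E S i j ∨ ∃ k ∈ T, Conn E S i k ∧ (k = j ∨ Conn (ConnOn E S N) T k j) := by
  induction h with
  | edge h => exact Or.inl (.edge h)
  | @cons i m j h hm _ ih =>
    rcases hm with hm | hm
    · rcases ih hj with h' | ⟨k, hk, h', h''⟩
      · exact Or.inl (.cons h hm h')
      · exact Or.inr ⟨k, hk, .cons h hm h', h''⟩
    · refine Or.inr ⟨m, hm, .edge h, ?_⟩
      by_cases hmj : m = j
      · exact Or.inl hmj
      refine Or.inr ?_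
      rcases ih hj with h' | ⟨k, hk, h', h''⟩
      · exact .edge ⟨hT hm, hj, hmj, h'⟩
      · by_cases hmk : m = k
        · subst hmk
          exact h''.resolve_left hmj
        · rcases h'' with rfl | h''
          · exact .edge ⟨hT hm, hj, hmj, h'⟩
          · exact .cons ⟨hT hm, hT hk, hmk, h'⟩ hk h''

theorem conn_connOn_iff {E : V → V → Prop} {S N T : Set V} {i j : V} (hT : T ⊆ N)
    (hi : i ∈ N) (hj : j ∈ N) (hij : i ≠ j) :
    Conn (ConnOn E S N) T i j ↔ Conn E (S ∪ T) i j := by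
  refine ⟨conn_of_conn_connOn, fun h => ?_⟩
  rcases conn_union_split hT h hj with h' | ⟨k, hk, h', h''⟩
  · exact .edge ⟨hi, hj, hij, h'⟩
  · by_cases hik : i = k
    · subst hik
      exact h''.resolve_left hij
    · rcases h'' with rfl | h''
      · exact .edge ⟨hi, hj, hij, h'⟩
      · exact .cons ⟨hi, hT hk, hik, h'⟩ hk h''

/-! ### Paths in graphs with a single type of edge. -/

theorem IsPath.tail {G : MixedGraph V} {i j : V} {s t : Step V} {w : List (Step V)}
    (h : IsPath G i j (s :: t :: w)) : IsPath G s.tgt j (t :: w) := by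
  obtain ⟨-, hv, hc, -, hl, hn⟩ := h
  have hc' := List.isChain_cons_cons.1 hc
  exact ⟨by simp, fun x hx => hv x (List.mem_cons_of_mem _ hx), hc'.2, by simp [hc'.1],
    by simpa using hl, by simpa using (List.nodup_cons.1 hn).2⟩

theorem IsPath.exists_suffix {G : MixedGraph V} {i j : V} :
    ∀ {k : V} {w : List (Step V)}, IsPath G k j w → i ∈ w.map Step.tgt → i ≠ j →
      ∃ w', IsPath G i j w' ∧ w' <:+ w
  | _, [], h, _, _ => absurd rfl h.1
  | k, [s], h, hi, hij => by
    obtain ⟨-, -, -, -, hl, -⟩ := h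
    simp_all
  | k, s :: t :: w, h, hi, hij => by
    have hp := h.tail
    by_cases his : i = s.tgt
    · exact ⟨t :: w, his ▸ hp, List.suffix_cons _ _⟩
    · obtain ⟨w', hw', hs⟩ := hp.exists_suffix (i := i) (by simpa [his] using hi) hij
      exact ⟨w', hw', hs.trans (List.suffix_cons _ _)⟩

/-- All edges of `G` have the head marks `b` at both ends and form the relation `E`. -/
def HasOnlyEdges (G : MixedGraph V) (b : Bool) (E : V → V → Prop) : Prop :=
  ∀ s : Step V, s.valid G ↔ s.hs = b ∧ s.ht = b ∧ E s.src s.tgt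

theorem conn_of_isPath {G : MixedGraph V} {b : Bool} {E : V → V → Prop}
    (hG : HasOnlyEdges G b E) {S : Set V} {j : V} :
    ∀ {i : V} {w : List (Step V)}, IsPath G i j w →
      List.IsChain (fun a _ => a.tgt ∈ S) w → Conn E S i j
  | _, [], h, _ => absurd rfl h.1
  | i, [s], ⟨_, hv, _, hh, hl, _⟩, _ => by
    have := ((hG s).1 (hv s (by simp))).2.2
    simp only [List.head?_cons, Option.map_some, Option.some.injEq,
      List.getLast?_singleton] at hh hl
    exact .edge (hh ▸ hl ▸ this)
  | i, s :: t :: w, h, hS => by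
    have hS' := List.isChain_cons_cons.1 hS
    have := ((hG s).1 (h.2.1 s (by simp))).2.2
    have hh := h.2.2.2.1
    simp only [List.head?_cons, Option.map_some, Option.some.injEq] at hh
    exact .cons (hh ▸ this) hS'.1 (conn_of_isPath hG h.tail hS'.2)

theorem exists_isPath_of_conn {G : MixedGraph V} {b : Bool} {E : V → V → Prop}
    (hG : HasOnlyEdges G b E) {S : Set V} {i j : V} (h : Conn E S i j) (hij : i ≠ j) :
    ∃ w, IsPath G i j w ∧ List.IsChain (fun a _ => a.tgt ∈ S) w := by
  have single : ∀ {i j : V}, E i j → i ≠ j →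
      ∃ w, IsPath G i j w ∧ List.IsChain (fun a _ => a.tgt ∈ S) w := fun {i j} h hij =>
    ⟨[⟨i, j, b, b⟩], ⟨by simp, by simp [hG _, h], List.isChain_singleton _, rfl, rfl,
      by simp [hij]⟩, List.isChain_singleton _⟩
  induction h with
  | edge h => exact single h hij
  | @cons i k j h hk _ ih =>
    by_cases hkj : k = j
    · exact single (hkj ▸ h) hij
    by_cases hik : i = k
    · subst hik
      exact ih hkj
    obtain ⟨w, hw, hS⟩ := ih hkj
    by_cases hi : i ∈ w.map Step.tgt
    · obtain ⟨w', hw', hs⟩ := hw.exists_suffix hi hij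
      exact ⟨w', hw', hS.suffix hs⟩
    · obtain ⟨hne, hv, hc, hh, hl, hn⟩ := hw
      cases w with
      | nil => exact absurd rfl hne
      | cons t w =>
        simp only [List.head?_cons, Option.map_some, Option.some.injEq] at hh
        refine ⟨⟨i, k, b, b⟩ :: t :: w, ⟨by simp, ?_, ?_, rfl, by simpa using hl, ?_⟩, ?_⟩
        · intro x hx
          rcases List.mem_cons.1 hx with rfl | hx
          · simp [hG _, h]
          · exact hv x hx
        · exact List.isChain_cons_cons.2 ⟨hh.symm, hc⟩
        · refine List.nodup_cons.2 ⟨?_, hn⟩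
          simpa [hik] using hi
        · exact List.isChain_cons_cons.2 ⟨hk, hS⟩

theorem isChain_congr_of_mem {α : Type} {R R' : α → α → Prop} :
    ∀ {l : List α}, (∀ a ∈ l, ∀ b ∈ l, R a b ↔ R' a b) → (l.IsChain R ↔ l.IsChain R')
  | [], _ => by simp
  | [_], _ => by simp
  | a :: b :: l, h => by
    rw [List.isChain_cons_cons, List.isChain_cons_cons, h a (by simp) b (by simp),
      isChain_congr_of_mem fun x hx y hy =>
        h x (List.mem_cons_of_mem _ hx) y (List.mem_cons_of_mem _ hy)]

/-- m-separation in a graph with a single type of edge, given the set `S` of admissible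
inner nodes. -/
theorem mSep_iff_conn {G : MixedGraph V} {b : Bool} {E : V → V → Prop}
    (hG : HasOnlyEdges G b E) {A B C S : Set V} (hAB : Disjoint A B)
    (hS : ∀ v, v ∈ S ↔ (b = true ∧ v ∈ C ∪ G.anSet C) ∨
      (b = false ∧ v ∈ G.nodes \ (A ∪ B ∪ C))) :
    MSep G A B C ↔ ∀ i ∈ A, ∀ j ∈ B, ¬ Conn E S i j := by
  have key : ∀ i j w, IsPath G i j w →
      (MConnPath G (G.nodes \ (A ∪ B ∪ C)) C w ↔
        List.IsChain (fun a _ => a.tgt ∈ S) w) := by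
    intro i j w hw
    refine isChain_congr_of_mem fun a ha c hc => ?_
    have ha' := (hG a).1 (hw.2.1 a ha)
    have hc' := (hG c).1 (hw.2.1 c hc)
    rw [ha'.2.1, hc'.1, hS]
    cases b <;> simp
  constructor
  · intro h i hi j hj hc
    obtain ⟨w, hw, hwS⟩ := exists_isPath_of_conn hG hc (hAB.ne_of_mem hi hj)
    exact h i hi j hj w hw ((key i j w hw).2 hwS)
  · intro h i hi j hj w hw hm
    exact h i hi j hj (conn_of_isPath hG hw ((key i j w hw).1 hm))

namespace MixedGraph

theorem anSet_eq_empty {G : MixedGraph V} (h : ∀ i j, ¬ G.arrow i j) (C : Set V) :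
    G.anSet C = ∅ := by
  refine Set.eq_empty_iff_forall_notMem.2 ?_
  rintro a ⟨c, -, hac⟩
  induction hac with
  | single h' => exact h _ _ h'
  | tail _ h' => exact h _ _ h'

theorem IsUG.hasOnlyEdges {G : MixedGraph V} (h : G.IsUG) :
    HasOnlyEdges G false G.line := by
  rintro ⟨x, y, _ | _, _ | _⟩ <;> simp [Step.valid, h.2.1, h.2.2]

theorem IsBG.hasOnlyEdges {G : MixedGraph V} (h : G.IsBG) :
    HasOnlyEdges G true G.arc := by
  rintro ⟨x, y, _ | _, _ | _⟩ <;> simp [Step.valid, h.2.1, h.2.2]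

theorem IsUG.mSep_iff {G : MixedGraph V} (h : G.IsUG) {A B C : Set V}
    (hAB : Disjoint A B) :
    MSep G A B C ↔ ∀ i ∈ A, ∀ j ∈ B, ¬ Conn G.line (G.nodes \ (A ∪ B ∪ C)) i j :=
  mSep_iff_conn h.hasOnlyEdges hAB (by simp)

theorem IsBG.mSep_iff {G : MixedGraph V} (h : G.IsBG) {A B C : Set V}
    (hAB : Disjoint A B) :
    MSep G A B C ↔ ∀ i ∈ A, ∀ j ∈ B, ¬ Conn G.arc C i j :=
  mSep_iff_conn h.hasOnlyEdges hAB (by simp [anSet_eq_empty h.2.1])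

end MixedGraph

/-- To identify the model of a graph on the remaining nodes with the reduced model, it
suffices to compare the m-separations. -/
theorem jm_eq_alphaIM {G H : MixedGraph V} {M C : Set V} (hC : C ⊆ G.nodes)
    (hH : H.nodes = G.nodes \ (M ∪ C))
    (hsep : ∀ A B D, A ⊆ H.nodes → B ⊆ H.nodes → D ⊆ H.nodes → Disjoint A B →
      (MSep H A B D ↔ MSep G A B (D ∪ C))) :
    Jm H = alphaIM (Jm G) M C := by
  ext ⟨A, B, D⟩
  simp only [Jm, alphaIM, Set.mem_ofPred_eq, ← Set.disjoint_iff_inter_eq_empty,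
    Set.disjoint_union_left, Set.disjoint_union_right, Set.union_subset_iff]
  have hsub : ∀ X : Set V, X ⊆ H.nodes ↔ X ⊆ G.nodes ∧ Disjoint X M ∧ Disjoint X C := by
    intro X
    rw [hH, Set.subset_sdiff, Set.disjoint_union_right]
  constructor
  · rintro ⟨hA, hB, hD, hAB, hAD, hBD, hs⟩
    have hs' := (hsep A B D hA hB hD hAB).1 hs
    rw [hsub] at hA hB hD
    tauto
  · rintro ⟨⟨hA, hB, ⟨hD, -⟩, hAB, ⟨hAD, -⟩, ⟨hBD, -⟩, hs⟩, h⟩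
    have hA' := (hsub A).2 (by tauto)
    have hB' := (hsub B).2 (by tauto)
    have hD' := (hsub D).2 (by tauto)
    exact ⟨hA', hB', hD', hAB, hAD, hBD, (hsep A B D hA' hB' hD' hAB).2 hs⟩

namespace MixedGraph

theorem IsUG.exists_alphaIM {G : MixedGraph V} {M C : Set V} (hG : G.IsUG)
    (hM : M ⊆ G.nodes) (hC : C ⊆ G.nodes) (hMC : Disjoint M C) :
    ∃ H : MixedGraph V, H.IsUG ∧ H.nodes = G.nodes \ (M ∪ C) ∧
      Jm H = alphaIM (Jm G) M C := by
  let H : MixedGraph V :=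
    { nodes := G.nodes \ (M ∪ C)
      arrow := fun _ _ => False
      arc := fun _ _ => False
      line := ConnOn G.line M (G.nodes \ (M ∪ C)) }
  have hH : H.IsUG := by
    refine ⟨⟨⟨fun _ _ => id, ?_, ?_⟩, fun i => ⟨id, id, fun h => h.2.2.1 rfl⟩,
      hG.1.2.2.subset Set.sdiff_subset⟩, fun _ _ => id, fun _ _ => id⟩
    · exact fun i j h => ⟨h.2.1, h.1, h.2.2.1.symm, h.2.2.2.symm hG.1.1.2.1⟩
    · rintro i j (h | h | h)
      exacts [h.elim, h.elim, ⟨h.1, h.2.1⟩]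
  refine ⟨H, hH, rfl, jm_eq_alphaIM hC rfl fun A B D hA hB hD hAB => ?_⟩
  have hS : M ∪ (H.nodes \ (A ∪ B ∪ D)) = G.nodes \ (A ∪ B ∪ (D ∪ C)) := by
    ext v
    have hA' := @hA v
    have hB' := @hB v
    have hD' := @hD v
    have hM' := @hM v
    have hMC' := @Set.disjoint_left.1 hMC v
    simp only [H, Set.mem_union, Set.mem_sdiff] at *
    tauto
  rw [hH.mSep_iff hAB, hG.mSep_iff hAB, ← hS]
  refine forall₂_congr fun i hi => forall₂_congr fun j hj => not_congr ?_
  exact conn_connOn_iff Set.sdiff_subset (hA hi) (hB hj) (hAB.ne_of_mem hi hj)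

theorem IsBG.exists_alphaIM {G : MixedGraph V} {M C : Set V} (hG : G.IsBG)
    (hC : C ⊆ G.nodes) :
    ∃ H : MixedGraph V, H.IsBG ∧ H.nodes = G.nodes \ (M ∪ C) ∧
      Jm H = alphaIM (Jm G) M C := by
  let H : MixedGraph V :=
    { nodes := G.nodes \ (M ∪ C)
      arrow := fun _ _ => False
      arc := ConnOn G.arc C (G.nodes \ (M ∪ C))
      line := fun _ _ => False }
  have hH : H.IsBG := by
    refine ⟨⟨⟨?_, fun _ _ => id, ?_⟩, fun i => ⟨id, fun h => h.2.2.1 rfl, id⟩,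
      hG.1.2.2.subset Set.sdiff_subset⟩, fun _ _ => id, fun _ _ => id⟩
    · exact fun i j h => ⟨h.2.1, h.1, h.2.2.1.symm, h.2.2.2.symm hG.1.1.1⟩
    · rintro i j (h | h | h)
      exacts [h.elim, ⟨h.1, h.2.1⟩, h.elim]
  refine ⟨H, hH, rfl, jm_eq_alphaIM hC rfl fun A B D hA hB hD hAB => ?_⟩
  rw [hH.mSep_iff hAB, hG.mSep_iff hAB, Set.union_comm D C]
  refine forall₂_congr fun i hi => forall₂_congr fun j hj => not_congr ?_
  exact conn_connOn_iff hD (hA hi) (hB hj) (hAB.ne_of_mem hi hj)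

end MixedGraph

/-- (Corollary 3) The classes of undirected graphs and of
bidirected graphs are stable under marginalisation and conditioning. -/
theorem stmt_7 {V : Type} :
    (∀ (G : MixedGraph V) (M C : Set V), G.IsUG → M ⊆ G.nodes → C ⊆ G.nodes →
      Disjoint M C →
      ∃ H : MixedGraph V, H.IsUG ∧ H.nodes = G.nodes \ (M ∪ C) ∧
        Jm H = alphaIM (Jm G) M C) ∧
    (∀ (G : MixedGraph V) (M C : Set V), G.IsBG → M ⊆ G.nodes → C ⊆ G.nodes →
      Disjoint M C →
      ∃ H : MixedGraph V, H.IsBG ∧ H.nodes = G.nodes \ (M ∪ C) ∧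
        Jm H = alphaIM (Jm G) M C) := by
  exact ⟨fun _ _ _ hG hM hC hMC => hG.exists_alphaIM hM hC hMC,
    fun _ _ _ hG _ hC _ => hG.exists_alphaIM hC⟩

end StableMixedGraphs
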